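/- If there exists a counterexample to the little finitistic dimension conjecture, i.e. a field k and a finite dimensional k-algebra C with findim C = ∞, then there exist a field k' and a finite dimensional k'-algebra Λ such that findim Λ = ∞ and findim Λᵒᵖ = 0. -/

import Mathlib

universe u

/-- `ProjDimLE R n M` : the left `R`-module `M` has projective dimension `≤ n`. -/
def ProjDimLE (R : Type u) [Ring R] :
    ℕ → (M : Type u) → [AddCommGroup M] → [Module R M] → Prop
  | 0, M, _, _ => Module.Projective R M
  | (n+1), M, _, _ => ∃ (P : Type u) (_ : AddCommGroup P) (_ : Module R P)
      (f : P →ₗ[R] M), Module.Projective R P ∧ Function.Surjective f ∧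
        ProjDimLE R n (LinearMap.ker f)

/-- The projective dimension of `M` as a left `R`-module, valued in `ℕ∞`
(equal to `⊤` if no finite projective resolution exists). -/
noncomputable def projDim (R : Type u) [Ring R]
    (M : Type u) [AddCommGroup M] [Module R M] : ℕ∞ :=
  sInf ((↑) '' {n : ℕ | ProjDimLE R n M})

/-- The little finitistic dimension of a ring `Λ`:
the supremum of the projective dimensions of the finitely generated right
`Λ`-modules (i.e. left `Λᵐᵒᵖ`-modules) of finite projective dimension. -/
noncomputable def findim (Λ : Type u) [Ring Λ] : ℕ∞ :=
  sSup {d : ℕ∞ | ∃ (M : Type u) (_ : AddCommGroup M) (_ : Module Λᵐᵒᵖ M),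
    Module.Finite Λᵐᵒᵖ M ∧ projDim Λᵐᵒᵖ M = d ∧ d ≠ ⊤}

/-- The big finitistic dimension of a ring `Λ`:
the supremum of the projective dimensions of all right
`Λ`-modules (i.e. left `Λᵐᵒᵖ`-modules) of finite projective dimension. -/
noncomputable def FinDim (Λ : Type u) [Ring Λ] : ℕ∞ :=
  sSup {d : ℕ∞ | ∃ (M : Type u) (_ : AddCommGroup M) (_ : Module Λᵐᵒᵖ M),
    projDim Λᵐᵒᵖ M = d ∧ d ≠ ⊤}

/-- A bundled finite dimensional algebra over a field. -/
structure FinDimAlgebra : Type (u + 1) where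
  /-- the base field -/
  k : Type u
  /-- the underlying type of the algebra -/
  carrier : Type u
  [fieldStruct : Field k]
  [ringStruct : Ring carrier]
  [algebraStruct : Algebra k carrier]
  [finDim : FiniteDimensional k carrier]

attribute [instance] FinDimAlgebra.fieldStruct FinDimAlgebra.ringStruct
  FinDimAlgebra.algebraStruct FinDimAlgebra.finDim

open CategoryTheory in
theorem projDimLE_iff_cat (R : Type u) [Ring R] (n : ℕ) :
    ∀ (M : Type u) [AddCommGroup M] [Module R M],
      ProjDimLE R n M ↔ HasProjectiveDimensionLE (ModuleCat.of R M) n := by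
  induction n with
  | zero =>
    intro M _ _
    rw [← projective_iff_hasProjectiveDimensionLE_zero]
    exact IsProjective.iff_projective M
  | succ n ih =>
    intro M _ _
    have key : ∀ (P : Type u) [AddCommGroup P] [Module R P] (f : P →ₗ[R] M),
        Module.Projective R P → Function.Surjective f →
        (HasProjectiveDimensionLE (ModuleCat.of R M) (n+1) ↔
          HasProjectiveDimensionLE (ModuleCat.of R (LinearMap.ker f)) n) := by
      intro P _ _ f hP hf
      exact (LinearMap.shortExact_shortComplexKer hf).hasProjectiveDimensionLT_X₃_iff n
        ((IsProjective.iff_projective P).1 hP)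
    constructor
    · rintro ⟨P, _, _, f, hP, hf, hk⟩
      exact (key P f hP hf).2 ((ih _).1 hk)
    · intro h
      refine ⟨M →₀ R, inferInstance, inferInstance, Finsupp.linearCombination R id,
        inferInstance, Finsupp.linearCombination_id_surjective R M, ?_⟩
      exact (ih _).2 ((key _ _ inferInstance (Finsupp.linearCombination_id_surjective R M)).1 h)

open CategoryTheory in
theorem projDimLE_succ_iff {R : Type u} [Ring R] (n : ℕ) {M P : Type u} [AddCommGroup M]
    [Module R M] [AddCommGroup P] [Module R P] (f : P →ₗ[R] M) (hP : Module.Projective R P)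
    (hf : Function.Surjective f) :
    ProjDimLE R (n+1) M ↔ ProjDimLE R n (LinearMap.ker f) := by
  rw [projDimLE_iff_cat, projDimLE_iff_cat]
  exact (LinearMap.shortExact_shortComplexKer hf).hasProjectiveDimensionLT_X₃_iff n
        ((IsProjective.iff_projective P).1 hP)

open CategoryTheory in
theorem projDimLE_congr {R : Type u} [Ring R] (n : ℕ) {M P : Type u} [AddCommGroup M]
    [Module R M] [AddCommGroup P] [Module R P] (e : P ≃ₗ[R] M) :
    ProjDimLE R n P ↔ ProjDimLE R n M := by
  rw [projDimLE_iff_cat, projDimLE_iff_cat]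
  exact ⟨fun _ => hasProjectiveDimensionLT_of_iso e.toModuleIso _,
    fun _ => hasProjectiveDimensionLT_of_iso e.symm.toModuleIso _⟩

/-- Restriction along a surjection with projective target preserves projective dimension. -/
theorem projDimLE_restrict {R S : Type u} [Ring R] [Ring S] [Module R S] [IsScalarTower R S S]
    (hS : Module.Projective R S) (hsurj : ∀ s : S, ∃ r : R, r • (1 : S) = s) (n : ℕ) :
    ∀ (M : Type u) [AddCommGroup M] [Module S M] [Module R M] [IsScalarTower R S M],
      ProjDimLE S n M ↔ ProjDimLE R n M := by
  classical
  have hproj : ∀ M : Type u, Module.Projective R (M →₀ S) := fun M =>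
    Module.Projective.of_equiv (finsuppLequivDFinsupp (ι := M) (M := S) R).symm
  induction n with
  | zero =>
    intro M _ _ _ _
    have hs := Finsupp.linearCombination_id_surjective S M
    constructor
    · intro (h : Module.Projective S M)
      obtain ⟨g, hg⟩ := Module.projective_lifting_property
        (Finsupp.linearCombination S (id : M → M)) LinearMap.id hs
      have := hproj M
      exact Module.Projective.of_split (g.restrictScalars R)
        ((Finsupp.linearCombination S (id : M → M)).restrictScalars R)
        (LinearMap.ext fun x => LinearMap.congr_fun hg x)
    · intro (h : Module.Projective R M)
      obtain ⟨g, hg⟩ := Module.projective_lifting_property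
        ((Finsupp.linearCombination S (id : M → M)).restrictScalars R) LinearMap.id hs
      have hlin : ∀ (s : S) (m : M), g (s • m) = s • g m := by
        intro s m
        obtain ⟨r, rfl⟩ := hsurj s
        rw [smul_assoc, one_smul, map_smul]
        ext i
        simp only [Finsupp.smul_apply, smul_eq_mul, smul_mul_assoc, one_mul]
      exact Module.Projective.of_split
        ({ toFun := g, map_add' := map_add g, map_smul' := hlin } : M →ₗ[S] (M →₀ S))
        (Finsupp.linearCombination S (id : M → M))
        (LinearMap.ext fun x => LinearMap.congr_fun hg x)
  | succ n ih =>
    intro M _ _ _ _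
    have hs := Finsupp.linearCombination_id_surjective S M
    rw [projDimLE_succ_iff n (Finsupp.linearCombination S (id : M → M)) inferInstance hs,
      projDimLE_succ_iff n ((Finsupp.linearCombination S (id : M → M)).restrictScalars R)
        (hproj M) hs, ih]
    refine projDimLE_congr n
      { toFun := fun x => ⟨x.1, x.2⟩
        invFun := fun x => ⟨x.1, x.2⟩
        map_add' := fun _ _ => rfl
        map_smul' := fun _ _ => rfl
        left_inv := fun _ => rfl
        right_inv := fun _ => rfl }

/-- An embedding of f.g. projective right modules splits if every nonzero left module
maps nontrivially to the ring. -/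
theorem split_of_cogen {S : Type u} [Ring S]
    (hS : ∀ (N : Type u) [AddCommGroup N] [Module S N], Nontrivial N → ∃ g : N →ₗ[S] S, g ≠ 0)
    {P Q : Type u} [AddCommGroup P] [AddCommGroup Q] [Module Sᵐᵒᵖ P] [Module Sᵐᵒᵖ Q]
    [Module.Projective Sᵐᵒᵖ P] [Module.Projective Sᵐᵒᵖ Q] [Module.Finite Sᵐᵒᵖ Q]
    (j : Q →ₗ[Sᵐᵒᵖ] P) (hj : Function.Injective j) :
    ∃ r : P →ₗ[Sᵐᵒᵖ] Q, r ∘ₗ j = LinearMap.id := by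
  let un : Sᵐᵒᵖ →ₗ[Sᵐᵒᵖ] S :=
    { toFun := MulOpposite.unop
      map_add' := fun _ _ => rfl
      map_smul' := fun _ _ => rfl }
  let opl : S →ₗ[Sᵐᵒᵖ] Sᵐᵒᵖ :=
    { toFun := MulOpposite.op
      map_add' := fun _ _ => rfl
      map_smul' := fun _ _ => rfl }
  let ρ : (P →ₗ[Sᵐᵒᵖ] S) →ₗ[S] (Q →ₗ[Sᵐᵒᵖ] S) :=
    { toFun := fun ψ => ψ ∘ₗ j
      map_add' := fun _ _ => rfl
      map_smul' := fun _ _ => rfl }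
  obtain ⟨n, f, g, -, -, hfg⟩ := Module.Finite.exists_comp_eq_id_of_projective Sᵐᵒᵖ Q
  let q : Fin n → Q := fun i => f (Pi.single i 1)
  let φ : Fin n → (Q →ₗ[Sᵐᵒᵖ] S) := fun i => un ∘ₗ LinearMap.proj i ∘ₗ g
  have hb : ∀ x : Q, ∑ i, MulOpposite.op (φ i x) • q i = x := by
    intro x
    have h1 : f (g x) = x := LinearMap.congr_fun hfg x
    conv_rhs => rw [← h1, ← LinearMap.sum_single_apply (fun _ => Sᵐᵒᵖ) (g x), map_sum]
    refine Finset.sum_congr rfl fun i _ => ?_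
    rw [← map_smul]
    congr 1
    ext k
    simp [φ, un, Pi.single_apply]
  have hsurj : Function.Surjective ρ := by
    by_contra hne
    have hW : LinearMap.range ρ ≠ ⊤ := fun h => hne (LinearMap.range_eq_top.1 h)
    obtain ⟨t, ht⟩ := hS _ (Submodule.Quotient.nontrivial_iff.2 hW)
    let G : (Q →ₗ[Sᵐᵒᵖ] S) →ₗ[S] S := t ∘ₗ (LinearMap.range ρ).mkQ
    have hG : G ≠ 0 := by
      intro h0
      apply ht
      ext x
      exact LinearMap.congr_fun h0 x
    let q0 : Q := ∑ i, MulOpposite.op (G (φ i)) • q i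
    have hev : ∀ χ : Q →ₗ[Sᵐᵒᵖ] S, G χ = χ q0 := by
      intro χ
      have h1 : χ = ∑ i, (χ (q i)) • φ i := by
        ext x
        conv_lhs => rw [← hb x]
        simp
      conv_lhs => rw [h1]
      simp [q0]
    have hz : ∀ ψ : P →ₗ[Sᵐᵒᵖ] S, ψ (j q0) = 0 := by
      intro ψ
      have h1 := hev (ρ ψ)
      have h2 : G (ρ ψ) = 0 := by
        have : (LinearMap.range ρ).mkQ (ρ ψ) = 0 := by simp
        simp only [G, LinearMap.comp_apply, this, map_zero]
      rw [h2] at h1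
      exact h1.symm
    have hjq : j q0 = 0 := by
      obtain ⟨s, hs⟩ := Module.projective_def'.1 (inferInstance : Module.Projective Sᵐᵒᵖ P)
      have h1 : s (j q0) = 0 := by
        ext i
        have := hz (un ∘ₗ Finsupp.lapply i ∘ₗ s)
        simpa [un] using this
      have h2 := LinearMap.congr_fun hs (j q0)
      simpa [h1] using h2.symm
    have hq0 : q0 = 0 := hj (by rw [hjq, map_zero])
    apply hG
    ext χ
    rw [hev, hq0, map_zero]
    rfl
  choose ψ hψ using fun i => hsurj (φ i)
  refine ⟨∑ i, (LinearMap.toSpanSingleton Sᵐᵒᵖ Q (q i)) ∘ₗ opl ∘ₗ ψ i, ?_⟩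
  ext x
  conv_rhs => rw [LinearMap.id_apply, ← hb x]
  have : ∀ i, ψ i (j x) = φ i x := fun i => LinearMap.congr_fun (hψ i) x
  simp [opl, this]

theorem projective_of_cogen {S : Type u} [Ring S] [IsNoetherianRing Sᵐᵒᵖ]
    (hS : ∀ (N : Type u) [AddCommGroup N] [Module S N], Nontrivial N → ∃ g : N →ₗ[S] S, g ≠ 0)
    (n : ℕ) : ∀ (M : Type u) [AddCommGroup M] [Module Sᵐᵒᵖ M] [Module.Finite Sᵐᵒᵖ M],
      ProjDimLE Sᵐᵒᵖ n M → Module.Projective Sᵐᵒᵖ M := by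
  induction n with
  | zero => intro M _ _ _ h; exact h
  | succ n ih =>
    intro M _ _ _ h
    obtain ⟨m, f, hf⟩ := Module.Finite.exists_fin' Sᵐᵒᵖ M
    have h1 := ih _ ((projDimLE_succ_iff n f inferInstance hf).1 h)
    obtain ⟨r, hr⟩ := split_of_cogen hS (LinearMap.ker f).subtype Subtype.val_injective
    let s : (Fin m → Sᵐᵒᵖ) →ₗ[Sᵐᵒᵖ] (Fin m → Sᵐᵒᵖ) :=
      LinearMap.id - (LinearMap.ker f).subtype ∘ₗ r
    have hs : LinearMap.ker f ≤ LinearMap.ker s := by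
      intro x hx
      have := LinearMap.congr_fun hr ⟨x, hx⟩
      simp only [LinearMap.comp_apply, Submodule.subtype_apply, LinearMap.id_apply] at this
      simp [s, this]
    let e := f.quotKerEquivOfSurjective hf
    refine Module.Projective.of_split ((LinearMap.ker f).liftQ s hs ∘ₗ e.symm.toLinearMap) f ?_
    ext y
    obtain ⟨x, rfl⟩ := hf y
    have : e.symm (f x) = (LinearMap.ker f).mkQ x := by
      rw [LinearEquiv.symm_apply_eq]; rfl
    simp [this, s]

/-- The algebra `A ⊕ DA ⊕ k ⊕ kx`. -/
def Lam (k A : Type u) [Field k] [Ring A] [Algebra k A] : Type u :=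
  A × Module.Dual k A × k × k

namespace Lam
variable {k A : Type u} [Field k] [Ring A] [Algebra k A]

instance : AddCommGroup (Lam k A) := inferInstanceAs (AddCommGroup (A × Module.Dual k A × k × k))
instance : Module k (Lam k A) := inferInstanceAs (Module k (A × Module.Dual k A × k × k))
instance [FiniteDimensional k A] : FiniteDimensional k (Lam k A) :=
  inferInstanceAs (FiniteDimensional k (A × Module.Dual k A × k × k))

/-- Constructor. -/
def mk (a : A) (f : Module.Dual k A) (c d : k) : Lam k A := (a, f, c, d)

/-- Component. -/
def a (x : Lam k A) : A := x.1
/-- Component. -/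
def f (x : Lam k A) : Module.Dual k A := x.2.1
/-- Component. -/
def c (x : Lam k A) : k := x.2.2.1
/-- Component. -/
def d (x : Lam k A) : k := x.2.2.2

theorem ext' {x y : Lam k A} (h1 : x.a = y.a) (h2 : ∀ t, x.f t = y.f t) (h3 : x.c = y.c)
    (h4 : x.d = y.d) : x = y :=
  Prod.ext h1 (Prod.ext (LinearMap.ext h2) (Prod.ext h3 h4))

instance : Mul (Lam k A) := ⟨fun x y =>
  mk (x.a * y.a) (x.f ∘ₗ LinearMap.mulLeft k y.a + x.c • y.f) (x.c * y.c) (x.c * y.d + x.d * y.c)⟩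
instance : One (Lam k A) := ⟨mk 1 0 1 0⟩

section
variable (x y : Lam k A) (r : k) (t : A)
@[simp] theorem mk_a (a : A) (f : Module.Dual k A) (c d : k) : (mk a f c d).a = a := rfl
@[simp] theorem mk_f (a : A) (f : Module.Dual k A) (c d : k) : (mk a f c d).f = f := rfl
@[simp] theorem mk_c (a : A) (f : Module.Dual k A) (c d : k) : (mk a f c d).c = c := rfl
@[simp] theorem mk_d (a : A) (f : Module.Dual k A) (c d : k) : (mk a f c d).d = d := rfl
@[simp] theorem add_a : (x + y).a = x.a + y.a := rfl
@[simp] theorem add_f : (x + y).f t = x.f t + y.f t := rfl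
@[simp] theorem add_c : (x + y).c = x.c + y.c := rfl
@[simp] theorem add_d : (x + y).d = x.d + y.d := rfl
@[simp] theorem smul_a : (r • x).a = r • x.a := rfl
@[simp] theorem smul_f : (r • x).f t = r * x.f t := rfl
@[simp] theorem smul_c : (r • x).c = r * x.c := rfl
@[simp] theorem smul_d : (r • x).d = r * x.d := rfl
@[simp] theorem zero_a : (0 : Lam k A).a = 0 := rfl
@[simp] theorem zero_f : (0 : Lam k A).f = 0 := rfl
@[simp] theorem zero_c : (0 : Lam k A).c = 0 := rfl
@[simp] theorem zero_d : (0 : Lam k A).d = 0 := rfl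
@[simp] theorem one_a : (1 : Lam k A).a = 1 := rfl
@[simp] theorem one_f : (1 : Lam k A).f = 0 := rfl
@[simp] theorem one_c : (1 : Lam k A).c = 1 := rfl
@[simp] theorem one_d : (1 : Lam k A).d = 0 := rfl
@[simp] theorem mul_a : (x * y).a = x.a * y.a := rfl
@[simp] theorem mul_f : (x * y).f t = x.f (y.a * t) + x.c * y.f t := rfl
@[simp] theorem mul_c : (x * y).c = x.c * y.c := rfl
@[simp] theorem mul_d : (x * y).d = x.c * y.d + x.d * y.c := rfl
end

instance : Ring (Lam k A) where
  __ := (inferInstance : AddCommGroup (Lam k A))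
  left_distrib x y z := by
    apply ext' <;> intros <;> simp [mul_add, add_mul] <;> ring
  right_distrib x y z := by
    apply ext' <;> intros <;> simp [mul_add, add_mul] <;> ring
  zero_mul x := by apply ext' <;> intros <;> simp
  mul_zero x := by apply ext' <;> intros <;> simp
  mul_assoc x y z := by
    apply ext' <;> intros <;> simp [mul_assoc, mul_add, add_mul] <;> ring
  one_mul x := by apply ext' <;> intros <;> simp
  mul_one x := by apply ext' <;> intros <;> simp

instance : Algebra k (Lam k A) := Algebra.ofModule
  (fun r x y => by apply ext' <;> intros <;> simp [mul_add, mul_assoc])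
  (fun r x y => by apply ext' <;> intros <;> simp [mul_add, mul_left_comm])

/-- Projection to `A`. -/
def toA : Lam k A →+* A where
  toFun := a
  map_one' := rfl
  map_mul' _ _ := rfl
  map_zero' := rfl
  map_add' _ _ := rfl

open MulOpposite in
theorem cogen (N : Type u) [AddCommGroup N] [Module (Lam k A)ᵐᵒᵖ N] (hN : Nontrivial N) :
    ∃ g : N →ₗ[(Lam k A)ᵐᵒᵖ] (Lam k A)ᵐᵒᵖ, g ≠ 0 := by
  letI : Module k N := Module.compHom N (algebraMap k (Lam k A)ᵐᵒᵖ)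
  haveI : IsScalarTower k (Lam k A)ᵐᵒᵖ N := ⟨fun r x n => by
    change (r • x) • n = algebraMap k (Lam k A)ᵐᵒᵖ r • x • n
    rw [Algebra.smul_def, mul_smul]⟩
  haveI : SMulCommClass k (Lam k A)ᵐᵒᵖ N := IsScalarTower.to_smulCommClass
  by_contra hno
  push Not at hno
  let E : Lam k A := mk 1 0 0 0
  let X : Lam k A := mk 0 0 0 1
  let act (l : Lam k A) : N →ₗ[k] N :=
    { toFun := fun n => op l • n
      map_add' := smul_add _
      map_smul' := fun r n => (smul_comm r (op l) n).symm }
  have act_mul : ∀ (x y : Lam k A) (n : N), op x • op y • n = op (y * x) • n := by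
    intro x y n; rw [op_mul, mul_smul]
  let U : Submodule k N := LinearMap.range (act E) ⊔ LinearMap.range (act X)
  have hE : ∀ n : N, op E • n ∈ U := fun n => Submodule.mem_sup_left ⟨n, rfl⟩
  have hX : ∀ n : N, op X • n ∈ U := fun n => Submodule.mem_sup_right ⟨n, rfl⟩
  have hU : ∀ n : N, n ∈ U := by
    intro n
    by_contra hn
    obtain ⟨ψ, hψn, hψ⟩ := Submodule.exists_le_ker_of_notMem hn
    have hlin : ∀ (l : (Lam k A)ᵐᵒᵖ) (m : N), ψ (l • m) = l.unop.c * ψ m := by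
      intro l m
      induction l with | _ l
      have h1 : l = mk l.a l.f 0 0 * E + l.d • X + l.c • 1 - l.c • E := by
        rw [eq_sub_iff_add_eq]
        apply ext' <;> intros <;> simp [E, X]
      have h2 : op l • m = op E • op (mk l.a l.f 0 0) • m + l.d • op X • m + l.c • m
          - l.c • op E • m := by
        conv_lhs => rw [h1]
        simp only [op_sub, op_add, op_smul, op_one, sub_smul, add_smul, smul_assoc, one_smul,
          act_mul]
      have hz : ∀ n ∈ U, ψ n = 0 := fun n hn => hψ hn
      rw [h2]
      simp [hz _ (hE _), hz _ (hX _)]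
    have h0 := hno
      { toFun := fun m => op (mk 0 0 0 (ψ m))
        map_add' := fun x y => by
          apply unop_injective
          apply ext' <;> intros <;> simp
        map_smul' := fun l x => by
          apply unop_injective
          rw [hlin]
          apply ext' <;> intros <;> simp [mul_comm] }
    have h1 := congrArg (fun z => (unop z).d) (LinearMap.congr_fun h0 n)
    exact hψn h1
  have hX0 : ∀ n : N, op X • n = 0 := by
    intro n
    obtain ⟨_, ⟨y, rfl⟩, _, ⟨z, rfl⟩, rfl⟩ := Submodule.mem_sup.1 (hU n)
    have h1 : E * X = 0 := by apply ext' <;> intros <;> simp [E, X]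
    have h2 : X * X = 0 := by apply ext' <;> intros <;> simp [X]
    simp [act, act_mul, h1, h2]
  have hE1 : ∀ n : N, ∃ m, n = op E • m := by
    intro n
    obtain ⟨_, ⟨y, rfl⟩, _, ⟨z, rfl⟩, rfl⟩ := Submodule.mem_sup.1 (hU n)
    exact ⟨y, by simp [act, hX0]⟩
  have hF : ∀ (f : Module.Dual k A) (n : N), op (mk 0 f 0 0) • n = 0 := by
    intro f n
    obtain ⟨m, rfl⟩ := hE1 n
    have : E * mk 0 f 0 0 = 0 := by apply ext' <;> intros <;> simp [E]
    rw [act_mul, this]; simp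
  have hEE : ∀ n : N, op E • n = n := by
    intro n
    obtain ⟨m, rfl⟩ := hE1 n
    have : E * E = E := by apply ext' <;> intros <;> simp [E]
    rw [act_mul, this]
  obtain ⟨n, hn⟩ := exists_ne (0 : N)
  obtain ⟨ψ, hψn, -⟩ := Submodule.exists_le_ker_of_notMem
    (p := (⊥ : Submodule k N)) (v := n) (by simpa using hn)
  let T (m : N) : Module.Dual k A :=
    { toFun := fun t => ψ (op (mk t 0 0 0 : Lam k A) • m)
      map_add' := fun t t' => by
        rw [← map_add, ← add_smul]
        congr 2
        apply unop_injective
        apply ext' <;> intros <;> simp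
      map_smul' := fun r t => by
        rw [RingHom.id_apply, ← map_smul, ← smul_assoc]
        congr 2
        apply unop_injective
        apply ext' <;> intros <;> simp }
  have hT : ∀ m t, T m t = ψ (op (mk t 0 0 0 : Lam k A) • m) := fun _ _ => rfl
  have h0 := hno
    { toFun := fun m => op (mk 0 (T m) 0 0)
      map_add' := fun x y => by
        apply unop_injective
        apply ext' <;> intros <;> simp [hT]
      map_smul' := fun l x => by
        induction l with | _ l
        apply unop_injective
        apply ext' <;> intros <;> simp [hT]
        rename_i t
        have h1 : l * mk t 0 0 0 = mk (l.a * t) 0 0 0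
            + mk 0 (l.f ∘ₗ LinearMap.mulLeft k t) 0 0 := by
          apply ext' <;> intros <;> simp
        rw [act_mul, h1, op_add, add_smul, hF, add_zero] }
  have h1 := congrArg (fun z => (unop z).f 1) (LinearMap.congr_fun h0 n)
  have h2 : ψ (op E • n) = 0 := h1
  rw [hEE] at h2
  exact hψn h2

end Lam

/-- **Theorem.** If there exists a counterexample to the little finitistic
dimension conjecture, then there exists a finite dimensional algebra `Λ` with
`findim Λ = ∞` and `findim Λᵒᵖ = 0`. -/
theorem exists_findim_eq_top_and_findim_op_eq_zero
    (h : ∃ C : FinDimAlgebra.{u}, findim C.carrier = ⊤) :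
    ∃ Λ : FinDimAlgebra.{u}, findim Λ.carrier = ⊤ ∧ findim Λ.carrierᵐᵒᵖ = 0 := by
  obtain ⟨C, hC⟩ := h
  refine ⟨⟨C.k, Lam C.k C.carrier⟩, ?_, ?_⟩
  · rw [eq_top_iff, ← hC]
    let k := C.k
    let A := C.carrier
    let π : (Lam k A)ᵐᵒᵖ →+* Aᵐᵒᵖ := Lam.toA.op
    apply sSup_le_sSup
    rintro d ⟨M, _, _, hM, hd, hd'⟩
    letI : Module (Lam k A)ᵐᵒᵖ Aᵐᵒᵖ := Module.compHom _ π
    letI : Module (Lam k A)ᵐᵒᵖ M := Module.compHom _ π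
    have hsm : ∀ (r : (Lam k A)ᵐᵒᵖ) (x : Aᵐᵒᵖ), r • x = π r * x := fun _ _ => rfl
    have hsm' : ∀ (r : (Lam k A)ᵐᵒᵖ) (x : M), r • x = π r • x := fun _ _ => rfl
    haveI : IsScalarTower (Lam k A)ᵐᵒᵖ Aᵐᵒᵖ Aᵐᵒᵖ := ⟨fun r x y => by simp [hsm, mul_assoc]⟩
    haveI : IsScalarTower (Lam k A)ᵐᵒᵖ Aᵐᵒᵖ M := ⟨fun r x y => by
      rw [hsm, hsm', mul_smul]⟩
    have hsurj : ∀ s : Aᵐᵒᵖ, ∃ r : (Lam k A)ᵐᵒᵖ, r • (1 : Aᵐᵒᵖ) = s := fun s =>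
      ⟨MulOpposite.op (Lam.mk s.unop 0 0 0), by rw [hsm, mul_one]; rfl⟩
    have hproj : Module.Projective (Lam k A)ᵐᵒᵖ Aᵐᵒᵖ := by
      refine Module.Projective.of_split (P := Aᵐᵒᵖ) (M := (Lam k A)ᵐᵒᵖ)
        { toFun := fun s => MulOpposite.op (Lam.mk s.unop 0 0 0)
          map_add' := fun x y => ?_
          map_smul' := fun r x => ?_ }
        { toFun := π
          map_add' := map_add π
          map_smul' := fun r x => by rw [smul_eq_mul, map_mul]; rfl } ?_
      · apply MulOpposite.unop_injective
        apply Lam.ext' <;> intros <;> simp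
      · apply MulOpposite.unop_injective
        apply Lam.ext' <;> intros <;> simp [hsm, π]
        rfl
      · rfl
    refine ⟨M, inferInstance, inferInstance, ?_, ?_, hd'⟩
    · haveI : Module.Finite (Lam k A)ᵐᵒᵖ Aᵐᵒᵖ :=
        Module.Finite.of_surjective
          (LinearMap.toSpanSingleton (Lam k A)ᵐᵒᵖ Aᵐᵒᵖ 1) hsurj
      exact Module.Finite.trans Aᵐᵒᵖ M
    · rw [← hd]
      unfold projDim
      congr 2
      ext n
      exact (projDimLE_restrict hproj hsurj n M).symm
  · let k := C.k
    let A := C.carrier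
    haveI : IsNoetherianRing (Lam k A)ᵐᵒᵖᵐᵒᵖ := IsNoetherianRing.of_finite k _
    refine le_antisymm (sSup_le ?_) bot_le
    rintro d ⟨M, _, _, hM, rfl, hd⟩
    have : ∃ n, ProjDimLE (Lam k A)ᵐᵒᵖᵐᵒᵖ n M := by
      by_contra hno
      push Not at hno
      apply hd
      unfold projDim
      rw [sInf_eq_top]
      rintro _ ⟨n, hn, -⟩
      exact (hno n hn).elim
    obtain ⟨n, hn⟩ := this
    have hp := projective_of_cogen (S := (Lam k A)ᵐᵒᵖ) Lam.cogen n M hn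
    exact sInf_le ⟨0, hp, rfl⟩
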